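/- Assume σ_1 < σ_2, I_1 ∩ I_2 ≠ ∅, σ_2 ∉ I_1 ∩ I_2 and χ_2^N − χ_2^S ∉ I_1 ∩ I_2. Let λ* be the maximum of G on [σ_1, χ_1^N + χ_1^S] and set φ* = λ*/(1 + λ*). Then φ* ∈ (0, 1), and for every φ ∈ (0, 1) the dispersion equation G(σ) = φ/(1 − φ) admits a solution σ ∈ [σ_1, χ_1^N + χ_1^S] if and only if φ ≤ φ*. -/

import Mathlib

/-- The function `g_i(σ) = (σ − χ^N) + χ^S·σ/√(σ² + 4αD_S)`. -/
noncomputable def gFun (χN χS α DS σ : ℝ) : ℝ :=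
  (σ - χN) + χS * σ / Real.sqrt (σ ^ 2 + 4 * α * DS)

/-- The function `h_i(σ) = (−σ − s(σ) − 2D_S·λ_i⁻)(−σ + s(σ) − 2D_S·λ_i⁺)` with
`s(σ) = √(σ² + 4αD_S)`, `λ⁻ = (χ^N + χ^S − σ)/D`, `λ⁺ = (χ^N − χ^S − σ)/D`. -/
noncomputable def hFun (χN χS α DS D σ : ℝ) : ℝ :=
  (-σ - Real.sqrt (σ ^ 2 + 4 * α * DS) - 2 * DS * ((χN + χS - σ) / D)) *
    (-σ + Real.sqrt (σ ^ 2 + 4 * α * DS) - 2 * DS * ((χN - χS - σ) / D))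

/-- The function
`G(σ) = −(χ_2^S D_2/(χ_1^S D_1))·(g_1(σ)/g_2(σ))·(h_2(σ)/h_1(σ))
         ·((χ_1^S)² − (χ_1^N − σ)²)/((χ_2^S)² − (χ_2^N − σ)²)`. -/
noncomputable def GFun (χ1N χ1S χ2N χ2S D1 D2 α DS σ : ℝ) : ℝ :=
  -(χ2S * D2 / (χ1S * D1)) * (gFun χ1N χ1S α DS σ / gFun χ2N χ2S α DS σ) *
    (hFun χ2N χ2S α DS D2 σ / hFun χ1N χ1S α DS D1 σ) *
    ((χ1S ^ 2 - (χ1N - σ) ^ 2) / (χ2S ^ 2 - (χ2N - σ) ^ 2))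

lemma aux_abs (c x : ℝ) (hc : 0 < c) : |x| < Real.sqrt (x ^ 2 + c) := by
  rw [← Real.sqrt_sq_eq_abs]
  exact Real.sqrt_lt_sqrt (sq_nonneg x) (by linarith)

lemma aux_mono (c x y : ℝ) (hc : 0 < c) (hxy : x < y) :
    x / Real.sqrt (x ^ 2 + c) < y / Real.sqrt (y ^ 2 + c) := by
  have hx := aux_abs c x hc
  have hy := aux_abs c y hc
  have hu2 : Real.sqrt (x ^ 2 + c) ^ 2 = x ^ 2 + c := Real.sq_sqrt (by positivity)
  have hv2 : Real.sqrt (y ^ 2 + c) ^ 2 = y ^ 2 + c := Real.sq_sqrt (by positivity)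
  set u := Real.sqrt (x ^ 2 + c)
  set v := Real.sqrt (y ^ 2 + c)
  have hu : 0 < u := lt_of_le_of_lt (abs_nonneg x) hx
  have hv : 0 < v := lt_of_le_of_lt (abs_nonneg y) hy
  have hp : x * y ≤ u * v := by
    calc x * y ≤ |x * y| := le_abs_self _
      _ = |x| * |y| := abs_mul x y
      _ ≤ u * v := mul_le_mul hx.le hy.le (abs_nonneg y) hu.le
  rw [div_lt_div_iff₀ hu hv]
  have key : (y * u - x * v) * (u + v) = (y - x) * (c + u * v - x * y) := by
    linear_combination y * hu2 - x * hv2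
  have h1 : 0 < (y * u - x * v) * (u + v) := by
    rw [key]
    exact mul_pos (by linarith) (by linarith)
  have h2 := pos_of_mul_pos_left h1 (by linarith)
  linarith

lemma g_mono (χN χS α DS x y : ℝ) (hS : 0 < χS) (hα : 0 < α) (hDS : 0 < DS) (hxy : x < y) :
    gFun χN χS α DS x < gFun χN χS α DS y := by
  unfold gFun
  have h := aux_mono (4 * α * DS) x y (by positivity) hxy
  have h2 := mul_lt_mul_of_pos_left h hS
  rw [mul_div_assoc, mul_div_assoc]
  linarith

lemma zero_mem (χN χS α DS x : ℝ) (hS : 0 < χS) (hα : 0 < α) (hDS : 0 < DS)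
    (h : gFun χN χS α DS x = 0) : χN - χS < x ∧ x < χN + χS := by
  unfold gFun at h
  have hx := aux_abs (4 * α * DS) x (by positivity)
  have hs : 0 < Real.sqrt (x ^ 2 + 4 * α * DS) := lt_of_le_of_lt (abs_nonneg x) hx
  rw [abs_lt] at hx
  rw [mul_div_assoc] at h
  have h1 : x / Real.sqrt (x ^ 2 + 4 * α * DS) < 1 := by rw [div_lt_one hs]; exact hx.2
  have h2 : -1 < x / Real.sqrt (x ^ 2 + 4 * α * DS) := by rw [lt_div_iff₀ hs]; linarith
  constructor <;> nlinarith

lemma h_neg (χN χS α DS D x : ℝ) (hα : 0 < α) (hDS : 0 < DS) (hD : 0 < D)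
    (h1 : χN - χS ≤ x) (h2 : x ≤ χN + χS) : hFun χN χS α DS D x < 0 := by
  unfold hFun
  have hx := aux_abs (4 * α * DS) x (by positivity)
  rw [abs_lt] at hx
  have e1 : 0 ≤ 2 * DS * ((χN + χS - x) / D) :=
    mul_nonneg (by positivity) (div_nonneg (by linarith) hD.le)
  have e2 : 2 * DS * ((χN - χS - x) / D) ≤ 0 :=
    mul_nonpos_of_nonneg_of_nonpos (by positivity)
      (div_nonpos_of_nonpos_of_nonneg (by linarith) hD.le)
  exact mul_neg_of_neg_of_pos (by linarith) (by linarith)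

lemma g_cont (χN χS α DS : ℝ) (hα : 0 < α) (hDS : 0 < DS) :
    Continuous (gFun χN χS α DS) := by
  unfold gFun
  have : ∀ x : ℝ, Real.sqrt (x ^ 2 + 4 * α * DS) ≠ 0 := fun x => by positivity
  fun_prop (disch := assumption)

lemma h_cont (χN χS α DS D : ℝ) : Continuous (hFun χN χS α DS D) := by
  unfold hFun
  fun_prop

/-- Assume `σ_1 < σ_2`, `I_1 ∩ I_2 ≠ ∅`, `σ_2 ∉ I_1 ∩ I_2` and
`χ_2^N − χ_2^S ∉ I_1 ∩ I_2`. Let `λ*` be the maximum of `G` on `[σ_1, χ_1^N + χ_1^S]`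
and set `φ* = λ*/(1 + λ*)`. Then `φ* ∈ (0, 1)`, and for every `φ ∈ (0, 1)` the
dispersion equation `G(σ) = φ/(1 − φ)` admits a solution `σ ∈ [σ_1, χ_1^N + χ_1^S]`
if and only if `φ ≤ φ*`. -/
theorem stmt16 (χ1N χ1S χ2N χ2S D1 D2 α DS : ℝ)
    (hχ1S : 0 < χ1S) (hχ2S : 0 < χ2S) (hD1 : 0 < D1) (hD2 : 0 < D2)
    (hα : 0 < α) (hDS : 0 < DS)
    (σ1 σ2 : ℝ)
    (hσ1 : gFun χ1N χ1S α DS σ1 = 0) (hσ2 : gFun χ2N χ2S α DS σ2 = 0)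
    (hlt : σ1 < σ2)
    (hne : (Set.Icc (χ1N - χ1S) (χ1N + χ1S) ∩ Set.Icc (χ2N - χ2S) (χ2N + χ2S)).Nonempty)
    (hs2 : σ2 ∉ Set.Icc (χ1N - χ1S) (χ1N + χ1S) ∩ Set.Icc (χ2N - χ2S) (χ2N + χ2S))
    (ha2 : χ2N - χ2S ∉ Set.Icc (χ1N - χ1S) (χ1N + χ1S) ∩ Set.Icc (χ2N - χ2S) (χ2N + χ2S))
    (lamStar : ℝ)
    (hmax : IsGreatest (GFun χ1N χ1S χ2N χ2S D1 D2 α DS '' Set.Icc σ1 (χ1N + χ1S)) lamStar) :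
    lamStar / (1 + lamStar) ∈ Set.Ioo (0 : ℝ) 1 ∧
    ∀ φ ∈ Set.Ioo (0 : ℝ) 1,
      ((∃ σ ∈ Set.Icc σ1 (χ1N + χ1S),
          GFun χ1N χ1S χ2N χ2S D1 D2 α DS σ = φ / (1 - φ)) ↔
        φ ≤ lamStar / (1 + lamStar)) := by
  obtain ⟨l1, u1⟩ := zero_mem _ _ _ _ _ hχ1S hα hDS hσ1
  obtain ⟨l2, u2⟩ := zero_mem _ _ _ _ _ hχ2S hα hDS hσ2
  have hb : χ1N + χ1S < σ2 := by
    by_contra hcon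
    exact hs2 ⟨⟨by linarith, by linarith⟩, by linarith, by linarith⟩
  have ha : χ2N - χ2S < χ1N - χ1S := by
    by_contra hcon
    obtain ⟨z, hz1, hz2⟩ := hne
    exact ha2 ⟨⟨by linarith, by linarith [hz1.2, hz2.1]⟩, by linarith, by linarith⟩
  have g2 : ∀ σ ∈ Set.Icc σ1 (χ1N + χ1S), gFun χ2N χ2S α DS σ < 0 := fun σ hσ => by
    rw [← hσ2]; exact g_mono _ _ _ _ _ _ hχ2S hα hDS (by linarith [hσ.2])
  have h1 : ∀ σ ∈ Set.Icc σ1 (χ1N + χ1S), hFun χ1N χ1S α DS D1 σ < 0 := fun σ hσ =>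
    h_neg _ _ _ _ _ _ hα hDS hD1 (by linarith [hσ.1]) hσ.2
  have h2 : ∀ σ ∈ Set.Icc σ1 (χ1N + χ1S), hFun χ2N χ2S α DS D2 σ < 0 := fun σ hσ =>
    h_neg _ _ _ _ _ _ hα hDS hD2 (by linarith [hσ.1]) (by linarith [hσ.2])
  have q2 : ∀ σ ∈ Set.Icc σ1 (χ1N + χ1S), 0 < χ2S ^ 2 - (χ2N - σ) ^ 2 := fun σ hσ => by
    have : 0 < (χ2S - (χ2N - σ)) * (χ2S + (χ2N - σ)) :=
      mul_pos (by linarith [hσ.1]) (by linarith [hσ.2])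
    linarith
  have hcont : ContinuousOn (GFun χ1N χ1S χ2N χ2S D1 D2 α DS) (Set.Icc σ1 (χ1N + χ1S)) := by
    unfold GFun
    refine ContinuousOn.mul (ContinuousOn.mul (ContinuousOn.mul continuousOn_const
      (ContinuousOn.div (g_cont _ _ _ _ hα hDS).continuousOn (g_cont _ _ _ _ hα hDS).continuousOn
        fun σ hσ => (g2 σ hσ).ne))
      (ContinuousOn.div (h_cont _ _ _ _ _).continuousOn (h_cont _ _ _ _ _).continuousOn
        fun σ hσ => (h1 σ hσ).ne))
      (ContinuousOn.div (by fun_prop) (by fun_prop) fun σ hσ => (q2 σ hσ).ne')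
  have hG0 : GFun χ1N χ1S χ2N χ2S D1 D2 α DS σ1 = 0 := by
    unfold GFun; rw [hσ1]; simp
  have hlam : 0 < lamStar := by
    obtain ⟨m, hm1, hm2⟩ := exists_between u1
    have hm : m ∈ Set.Icc σ1 (χ1N + χ1S) := ⟨hm1.le, hm2.le⟩
    refine lt_of_lt_of_le ?_ (hmax.2 ⟨m, hm, rfl⟩)
    have g1 : 0 < gFun χ1N χ1S α DS m := by
      rw [← hσ1]; exact g_mono _ _ _ _ _ _ hχ1S hα hDS hm1
    have q1 : 0 < χ1S ^ 2 - (χ1N - m) ^ 2 := by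
      have : 0 < (χ1S - (χ1N - m)) * (χ1S + (χ1N - m)) :=
        mul_pos (by linarith) (by linarith)
      linarith
    unfold GFun
    refine mul_pos (mul_pos (mul_pos_of_neg_of_neg ?_ (div_neg_of_pos_of_neg g1 (g2 m hm)))
      (div_pos_of_neg_of_neg (h2 m hm) (h1 m hm))) (div_pos q1 (q2 m hm))
    have : 0 < χ2S * D2 / (χ1S * D1) := by positivity
    linarith
  have h1l : 0 < 1 + lamStar := by linarith
  refine ⟨⟨div_pos hlam h1l, by rw [div_lt_one h1l]; linarith⟩, fun φ hφ => ?_⟩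
  have hφ1 : 0 < 1 - φ := by linarith [hφ.2]
  have hiff : φ ≤ lamStar / (1 + lamStar) ↔ φ / (1 - φ) ≤ lamStar := by
    rw [le_div_iff₀ h1l, div_le_iff₀ hφ1]
    constructor <;> intro h <;> linarith
  rw [hiff]
  constructor
  · rintro ⟨σ, hσ, h⟩
    rw [← h]
    exact hmax.2 ⟨σ, hσ, rfl⟩
  · intro h
    obtain ⟨M, hM, hMe⟩ := hmax.1
    have hsub := intermediate_value_Icc hM.1 (hcont.mono (Set.Icc_subset_Icc_right hM.2))
    rw [hG0, hMe] at hsub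
    obtain ⟨σ, hσ, he⟩ := hsub ⟨(div_pos hφ.1 hφ1).le, h⟩
    exact ⟨σ, ⟨hσ.1, hσ.2.trans hM.2⟩, he⟩
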